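/- arXiv:2509.22613 — 6 statements merged into one kernel-verified Lean document; each statement's English description precedes it below -/
import Mathlib

section
/- Let C be a finite nonempty type and f : C → ℝ. Let (Ω, 𝔽, P) be a probability space and X : Ω → (C → ℝ) a random vector such that each coordinate ω ↦ X(ω)_k is integrable with E[X_k] = f_k for every k, and ω ↦ log(Σ_k exp(X(ω)_k)) is integrable. Then KL(U_C ‖ softmax(f)) ≤ E[ KL(U_C ‖ softmax(X)) ]. -/
open Real MeasureTheory

/-- Softmax of a logit vector on a finite type. -/
noncomputable def softmax {C : Type*} [Fintype C] (g : C → ℝ) (k : C) : ℝ :=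
  Real.exp (g k) / ∑ k', Real.exp (g k')

/-- KL divergence from the uniform distribution on a finite type `C` to a probability
vector `q`: `KL(U_C ‖ q) = Σ_k (1/|C|) · log((1/|C|) / q_k)`. -/
noncomputable def klUniform {C : Type*} [Fintype C] (q : C → ℝ) : ℝ :=
  ∑ k, (1 / (Fintype.card C : ℝ)) * Real.log ((1 / (Fintype.card C : ℝ)) / q k)

lemma aux_kl_eq {C : Type*} [Fintype C] [Nonempty C] (g : C → ℝ) :
    klUniform (softmax g) = Real.log (∑ k, Real.exp (g k))
      - (∑ k, (1 / (Fintype.card C : ℝ)) * g k) - Real.log (Fintype.card C : ℝ) := by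
  have hn : (0 : ℝ) < Fintype.card C := by exact_mod_cast Fintype.card_pos
  have hS : 0 < ∑ k, Real.exp (g k) :=
    Finset.sum_pos (fun k _ => Real.exp_pos _) Finset.univ_nonempty
  unfold klUniform softmax
  have h : ∀ k, (1 / (Fintype.card C : ℝ)) * Real.log ((1 / (Fintype.card C : ℝ)) /
      (Real.exp (g k) / ∑ k', Real.exp (g k'))) =
      (1 / (Fintype.card C : ℝ)) * (Real.log (∑ k, Real.exp (g k))
        - Real.log (Fintype.card C : ℝ)) - (1 / (Fintype.card C : ℝ)) * g k := by
    intro k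
    rw [Real.log_div (by positivity) (by positivity), Real.log_div (by positivity) hS.ne',
      Real.log_exp, one_div, Real.log_inv]
    ring
  rw [Finset.sum_congr rfl (fun k _ => h k), Finset.sum_sub_distrib, Finset.sum_const,
    Finset.card_univ, nsmul_eq_mul]
  field_simp
  ring

lemma aux_lse {C : Type*} [Fintype C] [Nonempty C] (f x : C → ℝ) :
    Real.log (∑ k, Real.exp (f k)) + ∑ k, softmax f k * (x k - f k)
      ≤ Real.log (∑ k, Real.exp (x k)) := by
  have hS : 0 < ∑ k, Real.exp (f k) :=
    Finset.sum_pos (fun k _ => Real.exp_pos _) Finset.univ_nonempty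
  have hT : 0 < ∑ k, Real.exp (x k) :=
    Finset.sum_pos (fun k _ => Real.exp_pos _) Finset.univ_nonempty
  have h1 : ∑ k, softmax f k = 1 := by
    unfold softmax
    rw [← Finset.sum_div, div_self hS.ne']
  have hJ := convexOn_exp.map_sum_le (t := Finset.univ) (w := softmax f)
    (p := fun k => x k - f k) (fun k _ => by unfold softmax; positivity) h1
    (fun _ _ => Set.mem_univ _)
  simp only [smul_eq_mul] at hJ
  have h2 : ∑ k, softmax f k * Real.exp (x k - f k)
      = (∑ k, Real.exp (x k)) / ∑ k, Real.exp (f k) := by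
    rw [Finset.sum_div]
    refine Finset.sum_congr rfl fun k _ => ?_
    unfold softmax
    rw [Real.exp_sub]
    have := Real.exp_pos (f k)
    field_simp
  rw [h2] at hJ
  have h3 := (Real.le_log_iff_exp_le (by positivity)).2 hJ
  rw [Real.log_div hT.ne' hS.ne'] at h3
  linarith

/-- Diversity collapse of PG without KL regularization: if the random logit vector `X`
has coordinatewise mean `f` (and the log-sum-exp of `X` is integrable), then the KL
divergence from the uniform distribution to `softmax f` is at most the expected KL
divergence from the uniform distribution to `softmax X`. -/
theorem kl_uniform_le_expected_kl
    {C : Type*} [Fintype C] [Nonempty C] (f : C → ℝ)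
    {Ω : Type*} [MeasureSpace Ω] [IsProbabilityMeasure (volume : Measure Ω)]
    (X : Ω → C → ℝ)
    (hint : ∀ k, Integrable (fun ω => X ω k))
    (hmean : ∀ k, (∫ ω, X ω k) = f k)
    (hlse : Integrable (fun ω => Real.log (∑ k, Real.exp (X ω k)))) :
    klUniform (softmax f) ≤ ∫ ω, klUniform (softmax (X ω)) := by
  have hI : ∀ c : C → ℝ, Integrable (fun ω => ∑ k, c k * X ω k) := fun c =>
    integrable_finsetSum _ fun k _ => (hint k).const_mul _
  have hE : ∀ c : C → ℝ, (∫ ω, ∑ k, c k * X ω k) = ∑ k, c k * f k := by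
    intro c
    rw [integral_finsetSum _ fun k _ => (hint k).const_mul _]
    simp only [integral_const_mul, hmean]
  simp only [aux_kl_eq]
  have hI' := hI fun _ => 1 / (Fintype.card C : ℝ)
  have hE' := hE fun _ => 1 / (Fintype.card C : ℝ)
  have hd : Integrable (fun ω => Real.log (∑ k, Real.exp (X ω k))
      - ∑ k, (1 / (Fintype.card C : ℝ)) * X ω k) := hlse.sub hI'
  rw [integral_sub hd (integrable_const _), integral_sub hlse hI', hE']
  have key : (∫ ω, ((Real.log (∑ k, Real.exp (f k)) - ∑ k, softmax f k * f k)
      + ∑ k, softmax f k * X ω k)) ≤ ∫ ω, Real.log (∑ k, Real.exp (X ω k)) := by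
    refine integral_mono ((integrable_const _).add (hI _)) hlse fun ω => ?_
    have := aux_lse f (X ω)
    simp only [mul_sub, Finset.sum_sub_distrib] at this
    dsimp only
    linarith
  rw [integral_add (integrable_const _) (hI _), hE] at key
  simp only [integral_const, probReal_univ, one_smul] at key ⊢
  linarith
end

section
/- Let ι be a finite nonempty type, λ > 0, p : ι → ℝ, and let q, q_base : ι → ℝ be probability vectors (nonnegative, summing to 1) with q_base strictly positive. Suppose that for every k ∈ ι, q_k · Σ_{k'} q_{k'} · ( p_k − p_{k'} + λ·log(q_k / q_base_k) − λ·log(q_{k'} / q_base_{k'}) ) = 0. Then there exists a constant c ∈ ℝ such that for every k with q_k > 0, p_k + λ·log(q_k / q_base_k) = c; equivalently, for every k, either q_k = 0 or q_k is proportional to q_base_k · exp(p_k / λ). -/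
open Real

/-- The effect of KL regularization: at a stable point of the KL-regularized policy
gradient (reward `r = 1`, `p = 0`, coefficient `λ > 0`), on its support the output
distribution `q` satisfies `p_k + λ·log(q_k / q_base_k) = c` for a single constant `c`
(equivalently, on its support `q` is a Boltzmann reweighting of the base model). -/
theorem kl_regularized_stable_point
    {ι : Type*} [Fintype ι] [Nonempty ι]
    (lam : ℝ) (hlam : 0 < lam) (p q qbase : ι → ℝ)
    (hq0 : ∀ k, 0 ≤ q k) (hq1 : ∑ k, q k = 1)
    (hqb0 : ∀ k, 0 < qbase k) (hqb1 : ∑ k, qbase k = 1)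
    (hstat : ∀ k, q k * ∑ k', q k' *
        (p k - p k' + lam * Real.log (q k / qbase k)
          - lam * Real.log (q k' / qbase k')) = 0) :
    ∃ c : ℝ, ∀ k, 0 < q k → p k + lam * Real.log (q k / qbase k) = c := by
  refine ⟨∑ k', q k' * (p k' + lam * Real.log (q k' / qbase k')), fun k hk => ?_⟩
  have h := (mul_eq_zero.mp (hstat k)).resolve_left hk.ne'
  have e : ∑ k', q k' * (p k - p k' + lam * Real.log (q k / qbase k)
          - lam * Real.log (q k' / qbase k'))
      = (∑ k', q k') * (p k + lam * Real.log (q k / qbase k))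
        - ∑ k', q k' * (p k' + lam * Real.log (q k' / qbase k')) := by
    rw [Finset.sum_mul, ← Finset.sum_sub_distrib]
    exact Finset.sum_congr rfl fun x _ => by ring
  rw [e, hq1] at h
  linarith
end

section
/- Let V be a finite type with at least two elements and let f : V → V → V → ℝ. Suppose that for all i, j, k ∈ V with k ≠ i, f(i,j)[k] = max_{k' ∈ V} f(i,k)[k']. Then for every i ∈ V there exists a constant c_i ∈ ℝ such that f(i,j)[k] = c_i for all j ∈ V and all k ∈ V with k ≠ i. -/
/-- Stable points of Q-learning with outcome reward: if for all `k ≠ i` the Bellman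
stationarity `f(i,j)[k] = max_{k'} f(i,k)[k']` holds, then for each target `i` all
logits `f(i,j)[k]` with `k ≠ i` collapse to a single constant depending only on `i`. -/
theorem outcome_reward_stable_point_constant
    {V : Type*} [Fintype V] (hcard : 1 < Fintype.card V)
    (f : V → V → V → ℝ)
    (hstable : ∀ i j k, k ≠ i → f i j k = ⨆ k', f i k k') :
    ∀ i : V, ∃ c : ℝ, ∀ j k, k ≠ i → f i j k = c := by
  intro i
  haveI : Nontrivial V := Fintype.one_lt_card_iff_nontrivial.mp hcard
  obtain ⟨k₀, hk₀⟩ := exists_ne i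
  have key : ∀ j j' k k', k ≠ i → k' ≠ i → f i j' k' ≤ f i j k := by
    intro j j' k k' hk hk'
    rw [hstable i j k hk, hstable i j' k' hk', ← hstable i k k' hk']
    exact le_ciSup (Set.finite_range (f i k)).bddAbove k'
  exact ⟨f i i k₀, fun j k hk => le_antisymm (key _ _ _ _ hk₀ hk) (key _ _ _ _ hk hk₀)⟩
end

section
/- Let V be a finite nonempty type and A : V → V → Prop the edge relation of a directed acyclic graph (no directed cycles, in particular no self-loops), with indicator A[j,k] ∈ {0,1}. Say k reaches i if there is a directed path of length ≥ 1 from k to i, and let Anc(i) be the set of nodes that reach i. Define f* : V → V → V → ℝ by f*(i,j)[i] = A[j,i], and for k ≠ i: f*(i,j)[k] = 1 if A[j,k] = 1 and k ∈ Anc(i); f*(i,j)[k] = 0 if exactly one of (A[j,k] = 1) and (k ∈ Anc(i)) holds; and f*(i,j)[k] = −1 if A[j,k] = 0 and k ∉ Anc(i). Then: (a) for all i and all k ≠ i, max_{k' ∈ V} f*(i,k)[k'] = 1 if k ∈ Anc(i) and = 0 otherwise; and (b) f* satisfies the Bellman fixed-point equation f*(i,j)[k] = δ_{k=i} + (A[j,k]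 − 1) + S*(i,k) for all i, j, k, where S*(i,k) = 0 if k = i and S*(i,k) = max_{k'} f*(i,k)[k'] otherwise. -/
open scoped Classical

/-- The limiting logits of Q-learning with process reward: `fstar A i j i = A[j,i]`, and
for `k ≠ i` the value is `1`, `0`, or `-1` according to the adjacency `A[j,k]` and
whether `k` is an ancestor of `i`. -/
noncomputable def fstar {V : Type*} (A : V → V → Prop) (i j k : V) : ℝ :=
  if k = i then (if A j i then 1 else 0)
  else if A j k ∧ Relation.TransGen A k i then 1
  else if A j k ∨ Relation.TransGen A k i then 0
  else -1

/-- Bellman fixed-point identity for the limiting logits of Q-learning with process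
reward on a DAG: (a) for `k ≠ i`, `max_{k'} fstar A i k k'` is the indicator that `k` is
an ancestor of `i`; (b) `fstar` satisfies
`fstar(i,j)[k] = δ_{k=i} + (A[j,k] − 1) + S*(i,k)` with `S*(i,i) = 0` and
`S*(i,k) = max_{k'} fstar(i,k)[k']` for `k ≠ i`. -/
theorem fstar_bellman_fixed_point
    {V : Type*} [Fintype V] [Nonempty V]
    (A : V → V → Prop) (hacyc : ∀ v, ¬ Relation.TransGen A v v) :
    (∀ i k : V, k ≠ i →
      (⨆ k', fstar A i k k') = if Relation.TransGen A k i then (1 : ℝ) else 0) ∧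
    (∀ i j k : V,
      fstar A i j k =
        (if k = i then (1 : ℝ) else 0) +
          ((if A j k then (1 : ℝ) else 0) - 1) +
          (if k = i then 0 else ⨆ k', fstar A i k k')) := by
  have ha : ∀ i k : V, k ≠ i →
      (⨆ k', fstar A i k k') = if Relation.TransGen A k i then (1 : ℝ) else 0 := by
    intro i k hk
    have hb : BddAbove (Set.range (fstar A i k)) := (Set.finite_range _).bddAbove
    apply le_antisymm
    · apply ciSup_le
      intro x
      by_cases h : Relation.TransGen A k i
      · unfold fstar
        split_ifs <;> norm_num
      · have h1 : ¬ A k i := fun h' => h (Relation.TransGen.single h')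
        have h2 : ¬ (A k x ∧ Relation.TransGen A x i) :=
          fun h' => h (Relation.TransGen.head h'.1 h'.2)
        unfold fstar
        rw [if_neg h1, if_neg h2, if_neg h]
        split_ifs <;> norm_num
    · by_cases h : Relation.TransGen A k i
      · rw [if_pos h]
        rcases (Relation.TransGen.head'_iff.mp h) with ⟨x, hx, hxi⟩
        refine le_trans ?_ (le_ciSup hb x)
        rcases Relation.reflTransGen_iff_eq_or_transGen.mp hxi with h' | h'
        · subst h'
          simp [fstar, hx]
        · have hne : x ≠ i := by
            rintro rfl
            exact hacyc _ h'
          simp [fstar, hx, h', hne]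
      · rw [if_neg h]
        refine le_trans ?_ (le_ciSup hb i)
        unfold fstar
        rw [if_pos rfl]
        split_ifs <;> norm_num
  refine ⟨ha, ?_⟩
  intro i j k
  by_cases hk : k = i
  · subst hk
    simp [fstar]
  · rw [if_neg hk, if_neg hk, ha i k hk]
    unfold fstar
    by_cases h1 : A j k <;> by_cases h2 : Relation.TransGen A k i <;> simp [hk, h1, h2]
end

section
/- Let n ≥ 1 and let P, Q be n × n real matrices with all entries strictly positive and each row summing to 1 (row-stochastic). Suppose S, T ∈ ℝⁿ satisfy S + P·T = 0 and T + Q·S = 0. Then there exists c ∈ ℝ such that S = c·𝟙 and T = −c·𝟙, where 𝟙 is the all-ones vector. Conversely, every pair of this form satisfies both equations. -/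
/-- Block linear-system lemma: if `P`, `Q` are strictly positive row-stochastic matrices
and `S + P·T = 0`, `T + Q·S = 0`, then `S = c·𝟙` and `T = −c·𝟙` for some constant `c`;
conversely every such pair is a solution. -/
theorem block_system_constant_solutions
    (n : ℕ) (hn : 1 ≤ n)
    (P Q : Matrix (Fin n) (Fin n) ℝ)
    (hPpos : ∀ i j, 0 < P i j) (hQpos : ∀ i j, 0 < Q i j)
    (hProw : ∀ i, ∑ j, P i j = 1) (hQrow : ∀ i, ∑ j, Q i j = 1)
    (S T : Fin n → ℝ) :
    (S + P.mulVec T = 0 ∧ T + Q.mulVec S = 0) ↔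
      ∃ c : ℝ, (∀ i, S i = c) ∧ (∀ i, T i = -c) := by
  constructor
  · rintro ⟨h1, h2⟩
    have e1 : ∀ i, S i + ∑ j, P i j * T j = 0 := fun i => congrFun h1 i
    have e2 : ∀ i, T i + ∑ j, Q i j * S j = 0 := fun i => congrFun h2 i
    haveI : Nonempty (Fin n) := ⟨⟨0, hn⟩⟩
    obtain ⟨m, hm⟩ := Finite.exists_max S
    have hT : ∀ i, 0 ≤ T i + S m := by
      intro i
      have h : ∑ j, Q i j * S j ≤ ∑ j, Q i j * S m :=
        Finset.sum_le_sum fun j _ => mul_le_mul_of_nonneg_left (hm j) (hQpos i j).le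
      rw [← Finset.sum_mul, hQrow] at h
      linarith [e2 i]
    have hz : ∑ j, P m j * (T j + S m) = 0 := by
      simp only [mul_add, Finset.sum_add_distrib]
      rw [← Finset.sum_mul, hProw]
      linarith [e1 m]
    have hT' : ∀ j, T j = -S m := by
      intro j
      have h := (Finset.sum_eq_zero_iff_of_nonneg
        (fun j _ => mul_nonneg (hPpos m j).le (hT j))).1 hz j (Finset.mem_univ j)
      rcases mul_eq_zero.1 h with h | h
      · exact absurd h (hPpos m j).ne'
      · linarith
    refine ⟨S m, fun i => ?_, hT'⟩
    have h := e1 i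
    simp only [hT'] at h
    rw [← Finset.sum_mul, hProw] at h
    linarith
  · rintro ⟨c, hS, hT⟩
    constructor
    · funext i
      change S i + ∑ j, P i j * T j = 0
      simp only [hS, hT]
      rw [← Finset.sum_mul, hProw]
      ring
    · funext i
      change T i + ∑ j, Q i j * S j = 0
      simp only [hS, hT]
      rw [← Finset.sum_mul, hQrow]
      ring
end

section
/- Let V be a finite nonempty type and A : V → V → Prop the edge relation of a directed acyclic graph (no directed cycles, in particular no self-loops). Fix i ∈ V and suppose v : V → ℝ satisfies, for every k ∈ V, v(k) = δ_{k=i} + max_{k' : A k k'} v(k'), where the maximum over an empty set of out-neighbors is taken to be 0. Then v(k) = 1 if k = i or there is a directed path of length ≥ 1 from k to i, and v(k) = 0 otherwise; in particular, the recursion has a unique solution, the reachability indicator. -/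
open scoped Classical

/-- DAG Bellman-recursion uniqueness: on a directed acyclic graph, a solution of
`v(k) = δ_{k=i} + max_{k' : A k k'} v(k')` (with empty maximum taken to be `0`) is
exactly the reachability indicator of the target `i`; in particular the recursion has a
unique solution. -/
theorem dag_bellman_unique_solution
    {V : Type*} [Fintype V] [Nonempty V]
    (A : V → V → Prop) (hacyc : ∀ w, ¬ Relation.TransGen A w w)
    (i : V) (v : V → ℝ)
    (hrec : ∀ k,
      v k = (if k = i then (1 : ℝ) else 0) +
        (if h : (Finset.univ.filter fun k' => A k k').Nonempty then
          (Finset.univ.filter fun k' => A k k').sup' h v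
         else 0)) :
    ∀ k, v k = if k = i ∨ Relation.TransGen A k i then (1 : ℝ) else 0 := by
  have hwf : WellFounded (fun a b : V => Relation.TransGen A b a) := by
    haveI : IsTrans V (fun a b : V => Relation.TransGen A b a) :=
      ⟨fun a b c hab hbc => Relation.TransGen.trans hbc hab⟩
    haveI : Std.Irrefl (fun a b : V => Relation.TransGen A b a) := ⟨hacyc⟩
    exact Finite.wellFounded_of_trans_of_irrefl _
  intro k
  induction k using hwf.induction with
  | _ k ih =>
  have ih' : ∀ k', A k k' →
      v k' = if k' = i ∨ Relation.TransGen A k' i then (1 : ℝ) else 0 :=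
    fun k' h => ih k' (Relation.TransGen.single h)
  have hM : (if h : (Finset.univ.filter fun k' => A k k').Nonempty then
          (Finset.univ.filter fun k' => A k k').sup' h v
         else 0) = if Relation.TransGen A k i then (1 : ℝ) else 0 := by
    by_cases hr : Relation.TransGen A k i
    · obtain ⟨m, hm, hmi⟩ : ∃ m, A k m ∧ (m = i ∨ Relation.TransGen A m i) := by
        rcases Relation.TransGen.head'_iff.1 hr with ⟨m, hm, hmi⟩
        refine ⟨m, hm, ?_⟩
        rcases Relation.reflTransGen_iff_eq_or_transGen.1 hmi with h | h
        · exact Or.inl h.symm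
        · exact Or.inr h
      have hmem : m ∈ Finset.univ.filter fun k' => A k k' := by simpa using hm
      rw [dif_pos ⟨m, hmem⟩, if_pos hr]
      apply le_antisymm
      · apply Finset.sup'_le
        intro b hb
        rw [ih' b (by simpa using hb)]
        split_ifs <;> norm_num
      · have h1 := Finset.le_sup' v hmem
        rwa [ih' m hm, if_pos hmi] at h1
    · rw [if_neg hr]
      split_ifs with h
      · have hz : ∀ b ∈ Finset.univ.filter (fun k' => A k k'), v b = 0 := by
          intro b hb
          have hb' : A k b := by simpa using hb
          rw [ih' b hb', if_neg]
          rintro (rfl | hbi)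
          · exact hr (Relation.TransGen.single hb')
          · exact hr (Relation.TransGen.head hb' hbi)
        apply le_antisymm
        · exact Finset.sup'_le _ _ fun b hb => (hz b hb).le
        · obtain ⟨b, hb⟩ := h
          have h1 := Finset.le_sup' v hb
          rwa [hz b hb] at h1
      · rfl
  rw [hrec k, hM]
  by_cases hk : k = i
  · subst hk
    simp [hacyc k]
  · simp [hk]
end
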